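/- Let Z be a curve in ℝ^d, let k ≥ 2 and K ≥ 2(k−1)+1 be integers, and let 0 ≤ s_1 < s_2 < … < s_K ≤ 1. Then for every polygonal curve Y with at most k vertices there exists an index i with 1 ≤ i ≤ K−2 such that d_F(Z, Y) ≥ (1/2)·d_F(Z[s_i, s_{i+2}], segment from Z(s_i) to Z(s_{i+2})). -/

import Mathlib

open Set

noncomputable section

namespace Jaywalk

variable {d : ℕ}

/-- An orientation-preserving reparameterization of `[0,1]`: a continuous, strictly
increasing bijection of `[0,1]` onto itself with `f 0 = 0` and `f 1 = 1`. -/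
structure IsReparam (f : ℝ → ℝ) : Prop where
  contOn : ContinuousOn f (Icc 0 1)
  strictMonoOn : StrictMonoOn f (Icc 0 1)
  mapsTo : MapsTo f (Icc 0 1) (Icc 0 1)
  surjOn : SurjOn f (Icc 0 1) (Icc 0 1)
  map_zero : f 0 = 0
  map_one : f 1 = 1

/-- The width of a reparameterization `f` with respect to curves `X Y : [0,1] → ℝ^d`. -/
def frechetWidth (X Y : ℝ → EuclideanSpace ℝ (Fin d)) (f : ℝ → ℝ) : ℝ :=
  ⨆ t : Icc (0:ℝ) 1, ‖X (f ↑t) - Y ↑t‖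

/-- The Fréchet distance between two curves `X Y : [0,1] → ℝ^d`. -/
def frechetDist (X Y : ℝ → EuclideanSpace ℝ (Fin d)) : ℝ :=
  sInf {w | ∃ f, IsReparam f ∧ w = frechetWidth X Y f}

/-- The segment from `p` to `q`, as a curve `t ↦ (1-t)·p + t·q`. -/
def seg (p q : EuclideanSpace ℝ (Fin d)) : ℝ → EuclideanSpace ℝ (Fin d) :=
  fun t => (1 - t) • p + t • q

/-- The subcurve `Z[s,t]`, affinely reparameterized over `[0,1]`. -/
def subcurve (Z : ℝ → EuclideanSpace ℝ (Fin d)) (s t : ℝ) : ℝ → EuclideanSpace ℝ (Fin d) :=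
  fun τ => Z (s + τ * (t - s))

/-- Vertices extended to all of `ℕ` (clamped at `n`). -/
def vtx {n : ℕ} (v : Fin (n+1) → EuclideanSpace ℝ (Fin d)) (i : ℕ) :
    EuclideanSpace ℝ (Fin d) :=
  v ⟨min i n, Nat.lt_succ_of_le (min_le_right i n)⟩

/-- The uniformly parameterized polygonal curve through the vertices `v 0, …, v n`. -/
def polyCurve {n : ℕ} (v : Fin (n+1) → EuclideanSpace ℝ (Fin d)) :
    ℝ → EuclideanSpace ℝ (Fin d) :=
  fun t =>
    (1 - (t * n - ⌊t * n⌋₊)) • vtx v ⌊t * n⌋₊ + (t * n - ⌊t * n⌋₊) • vtx v (⌊t * n⌋₊ + 1)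

/-- Concatenation of two curves (sharing an endpoint). -/
def concat (A B : ℝ → EuclideanSpace ℝ (Fin d)) : ℝ → EuclideanSpace ℝ (Fin d) :=
  fun t => if t ≤ 1/2 then A (2 * t) else B (2 * t - 1)

/-- Concatenation of a finite list of curves. -/
def concatList : List (ℝ → EuclideanSpace ℝ (Fin d)) → ℝ → EuclideanSpace ℝ (Fin d)
  | [] => fun _ => 0
  | [A] => A
  | A :: B :: rest => concat A (concatList (B :: rest))

/-- Given curves `X Y`, the price of the tunnel from `a` to `b` (points of `[0,1]²`):
the Fréchet distance between the subcurve `X[a.1, b.1]` and the segment from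
`Y a.2` to `Y b.2`. -/
def tunnelPrice (X Y : ℝ → EuclideanSpace ℝ (Fin d)) (a b : ℝ × ℝ) : ℝ :=
  frechetDist (subcurve X a.1 b.1) (seg (Y a.2) (Y b.2))

open Classical in
/-- Indices of marked vertices in the greedy `μ`-simplification of the polygonal curve with
vertices `v 0, …, v n`:  start at vertex `0`; repeatedly jump to the first later vertex at
distance at least `μ` from the current one; finally also mark the last vertex `n`
(the sequence stabilizes at `n`). -/
def simplIdx (v : ℕ → EuclideanSpace ℝ (Fin d)) (μ : ℝ) (n : ℕ) : ℕ → ℕ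
  | 0 => 0
  | k+1 =>
    if h : ∃ j, simplIdx v μ n k < j ∧ j ≤ n ∧ μ ≤ ‖v j - v (simplIdx v μ n k)‖
    then Nat.find h
    else n

/-- The vertices of the `μ`-simplification (with the final vertex repeated). -/
def simplVerts {n : ℕ} (v : Fin (n+1) → EuclideanSpace ℝ (Fin d)) (μ : ℝ) :
    Fin (n+1) → EuclideanSpace ℝ (Fin d) :=
  fun k => vtx v (simplIdx (vtx v) μ n k.val)

/-- The `μ`-simplification `simpl(X, μ)` of the polygonal curve with vertices
`v 0, …, v n`: the polygonal curve through the marked vertices, in order. -/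
def simpl {n : ℕ} (v : Fin (n+1) → EuclideanSpace ℝ (Fin d)) (μ : ℝ) :
    ℝ → EuclideanSpace ℝ (Fin d) :=
  polyCurve (simplVerts v μ)

/-- `y` is the parameter of a vertex of a (uniformly parameterized) polygonal curve
with `n` edges. -/
def vertexParam (n : ℕ) (y : ℝ) : Prop := ∃ i : Fin (n+1), y = ((i : ℕ) : ℝ) / n

/-- The shortcut curve of `Y` determined by the list of shortcut parameter pairs,
starting from parameter `a`. -/
def shortcutFrom (Y : ℝ → EuclideanSpace ℝ (Fin d)) :
    List (ℝ × ℝ) → ℝ → ℝ → EuclideanSpace ℝ (Fin d)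
  | [], a => subcurve Y a 1
  | (y₁, y₂) :: rest, a =>
      concat (subcurve Y a y₁) (concat (seg (Y y₁) (Y y₂)) (shortcutFrom Y rest y₂))

/-- The shortcut parameter pairs form a nondecreasing sequence inside `[0,1]` and all
parameters are vertices of the polygonal curve with `n` edges. -/
def ValidShortcuts (n : ℕ) (L : List (ℝ × ℝ)) : Prop :=
  List.Chain' (· ≤ ·) ((0:ℝ) :: (L.flatMap fun p => [p.1, p.2]) ++ [1]) ∧
  ∀ p ∈ L, vertexParam n p.1 ∧ vertexParam n p.2

/-- The directed vertex-restricted `k`-shortcut Fréchet distance between a curve `X` and the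
polygonal curve with vertices `w 0, …, w n`: the infimum of the Fréchet distance between `X`
and any vertex-restricted shortcut curve of `polyCurve w` with at most `k` shortcuts. -/
def shortcutFrechetDist {n : ℕ} (X : ℝ → EuclideanSpace ℝ (Fin d))
    (w : Fin (n+1) → EuclideanSpace ℝ (Fin d)) (k : ℕ) : ℝ :=
  sInf {r | ∃ L : List (ℝ × ℝ), L.length ≤ k ∧ ValidShortcuts n L ∧
    r = frechetDist X (shortcutFrom (polyCurve w) L 0)}

/-- The directed vertex-restricted shortcut Fréchet distance (unbounded number of
shortcuts). -/
def shortcutFrechetDistUnbounded {n : ℕ} (X : ℝ → EuclideanSpace ℝ (Fin d))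
    (w : Fin (n+1) → EuclideanSpace ℝ (Fin d)) : ℝ :=
  sInf {r | ∃ L : List (ℝ × ℝ), ValidShortcuts n L ∧
    r = frechetDist X (shortcutFrom (polyCurve w) L 0)}

theorem IsReparam.of_strictMonoOn {f : ℝ → ℝ} (hc : ContinuousOn f (Icc 0 1))
    (hm : StrictMonoOn f (Icc 0 1)) (h0 : f 0 = 0) (h1 : f 1 = 1) : IsReparam f where
  contOn := hc
  strictMonoOn := hm
  mapsTo t ht := by
    have hl := hm.monotoneOn (left_mem_Icc.2 zero_le_one) ht ht.1
    have hr := hm.monotoneOn ht (right_mem_Icc.2 zero_le_one) ht.2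
    rw [h0] at hl
    rw [h1] at hr
    exact ⟨hl, hr⟩
  surjOn := by
    have h := intermediate_value_Icc zero_le_one hc
    rwa [h0, h1] at h
  map_zero := h0
  map_one := h1

theorem IsReparam.id : IsReparam fun t => t :=
  .of_strictMonoOn continuousOn_id (fun _ _ _ _ h => h) rfl rfl

/-- The reparameterization of `[0,1]` induced by restricting `f` to `[a,b]`. -/
theorem IsReparam.restrict {f : ℝ → ℝ} (hf : IsReparam f) {a b : ℝ} (ha : 0 ≤ a) (hab : a < b)
    (hb : b ≤ 1) : IsReparam fun τ => (f (a + τ * (b - a)) - f a) / (f b - f a) := by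
  have hmaps : MapsTo (fun τ : ℝ => a + τ * (b - a)) (Icc 0 1) (Icc 0 1) := by
    rintro τ ⟨h0, h1⟩
    constructor <;> nlinarith
  have hpos : 0 < f b - f a :=
    sub_pos.2 (hf.strictMonoOn ⟨ha, hab.le.trans hb⟩ ⟨ha.trans hab.le, hb⟩ hab)
  refine .of_strictMonoOn ?_ ?_ (by simp) ?_
  · exact ((hf.contOn.comp (by fun_prop) hmaps).sub continuousOn_const).div_const _
  · intro x hx y hy hxy
    have hlt : f (a + x * (b - a)) < f (a + y * (b - a)) :=
      hf.strictMonoOn (hmaps hx) (hmaps hy) (by nlinarith)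
    exact div_lt_div_of_pos_right (by linarith) hpos
  · have : a + 1 * (b - a) = b := by ring
    simp only [this]
    exact div_self hpos.ne'

theorem frechetWidth_nonneg (X Y : ℝ → EuclideanSpace ℝ (Fin d)) (f : ℝ → ℝ) :
    0 ≤ frechetWidth X Y f :=
  Real.iSup_nonneg fun _ => norm_nonneg _

theorem frechetDist_le {X Y : ℝ → EuclideanSpace ℝ (Fin d)} {f : ℝ → ℝ} {r : ℝ}
    (hf : IsReparam f) (h : ∀ t ∈ Icc (0 : ℝ) 1, ‖X (f t) - Y t‖ ≤ r) :
    frechetDist X Y ≤ r := by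
  have : Nonempty (Icc (0 : ℝ) 1) := ⟨⟨0, by simp⟩⟩
  calc frechetDist X Y ≤ frechetWidth X Y f :=
        csInf_le ⟨0, by rintro _ ⟨g, -, rfl⟩; exact frechetWidth_nonneg X Y g⟩ ⟨f, hf, rfl⟩
    _ ≤ r := ciSup_le fun t => h t t.2

theorem le_frechetDist {X Y : ℝ → EuclideanSpace ℝ (Fin d)} {r : ℝ}
    (h : ∀ f, IsReparam f → r ≤ frechetWidth X Y f) : r ≤ frechetDist X Y :=
  le_csInf ⟨_, _, .id, rfl⟩ (by rintro _ ⟨f, hf, rfl⟩; exact h f hf)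

theorem norm_sub_le_frechetWidth {X Y : ℝ → EuclideanSpace ℝ (Fin d)} {f : ℝ → ℝ}
    (hX : ContinuousOn X (Icc 0 1)) {C : ℝ} (hY : ∀ t ∈ Icc (0 : ℝ) 1, ‖Y t‖ ≤ C)
    (hf : IsReparam f) {t : ℝ} (ht : t ∈ Icc (0 : ℝ) 1) :
    ‖X (f t) - Y t‖ ≤ frechetWidth X Y f := by
  obtain ⟨B, hB⟩ := isCompact_Icc.exists_bound_of_continuousOn hX
  refine le_ciSup (f := fun t : Icc (0 : ℝ) 1 => ‖X (f ↑t) - Y ↑t‖) ⟨B + C, ?_⟩ ⟨t, ht⟩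
  rintro _ ⟨u, rfl⟩
  exact (norm_sub_le _ _).trans (add_le_add (hB _ (hf.mapsTo u.2)) (hY _ u.2))

theorem polyCurve_eq_of_mem_edge {n : ℕ} (v : Fin (n+1) → EuclideanSpace ℝ (Fin d)) {t : ℝ}
    {j : ℕ} (h1 : (j : ℝ) ≤ t * n) (h2 : t * n ≤ j + 1) :
    polyCurve v t = (1 - (t * n - j)) • vtx v j + (t * n - j) • vtx v (j + 1) := by
  rcases h2.lt_or_eq with h | h
  · have : ⌊t * n⌋₊ = j := (Nat.floor_eq_iff (j.cast_nonneg.trans h1)).2 ⟨h1, h⟩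
    simp only [polyCurve, this]
  · have : ⌊t * n⌋₊ = j + 1 := by
      rw [h]
      exact_mod_cast Nat.floor_natCast (R := ℝ) (j + 1)
    simp only [polyCurve, this]
    simp [h]

theorem exists_norm_polyCurve_le {n : ℕ} (v : Fin (n+1) → EuclideanSpace ℝ (Fin d)) :
    ∃ C, ∀ t ∈ Icc (0 : ℝ) 1, ‖polyCurve v t‖ ≤ C := by
  have hv (i : ℕ) : ‖vtx v i‖ ≤ ∑ l, ‖v l‖ :=
    Finset.single_le_sum (f := fun l => ‖v l‖) (fun _ _ => norm_nonneg _) (Finset.mem_univ _)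
  refine ⟨∑ l, ‖v l‖, fun t ht => ?_⟩
  have h1 := Nat.floor_le (mul_nonneg ht.1 n.cast_nonneg)
  have h2 := Nat.lt_floor_add_one (t * n)
  have hball := (convex_closedBall (0 : EuclideanSpace ℝ (Fin d)) (∑ l, ‖v l‖))
    (mem_closedBall_zero_iff.2 (hv ⌊t * n⌋₊)) (mem_closedBall_zero_iff.2 (hv (⌊t * n⌋₊ + 1)))
    (a := 1 - (t * n - ⌊t * n⌋₊)) (b := t * n - ⌊t * n⌋₊)
    (by linarith) (by linarith) (by ring)
  exact mem_closedBall_zero_iff.1 hball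

/-- A polygonal curve restricted to a part of an edge is a segment. -/
theorem polyCurve_eq_seg {n : ℕ} (v : Fin (n+1) → EuclideanSpace ℝ (Fin d)) {a b τ : ℝ} {j : ℕ}
    (hab : a ≤ b) (h1 : (j : ℝ) ≤ a * n) (h2 : b * n ≤ j + 1) (hτ : τ ∈ Icc (0 : ℝ) 1) :
    polyCurve v (a + τ * (b - a)) = seg (polyCurve v a) (polyCurve v b) τ := by
  have hn : a * n ≤ b * n := mul_le_mul_of_nonneg_right hab n.cast_nonneg
  have e : (a + τ * (b - a)) * n = a * n + τ * (b * n - a * n) := by ring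
  rw [polyCurve_eq_of_mem_edge v (j := j) (t := a) h1 (hn.trans h2),
    polyCurve_eq_of_mem_edge v (j := j) (t := b) (h1.trans hn) h2,
    polyCurve_eq_of_mem_edge v (j := j) (by rw [e]; nlinarith [hτ.1, hτ.2])
      (by rw [e]; nlinarith [hτ.1, hτ.2]), seg]
  module

theorem norm_seg_sub_seg_le {p q p' q' : EuclideanSpace ℝ (Fin d)} {r τ : ℝ}
    (hp : ‖p - p'‖ ≤ r) (hq : ‖q - q'‖ ≤ r) (hτ : τ ∈ Icc (0 : ℝ) 1) :
    ‖seg p q τ - seg p' q' τ‖ ≤ r := by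
  have e : seg p q τ - seg p' q' τ = (1 - τ) • (p - p') + τ • (q - q') := by
    simp only [seg]
    module
  rw [e]
  exact mem_closedBall_zero_iff.1 (convex_closedBall (0 : EuclideanSpace ℝ (Fin d)) r
    (mem_closedBall_zero_iff.2 hp) (mem_closedBall_zero_iff.2 hq)
    (sub_nonneg.2 hτ.2) hτ.1 (by ring))

/-- If `f` matches `Z` to `Y`, and `Y` is a segment on `[a,b]`, then the matched subcurve of `Z`
is within twice the width of the segment between its endpoints. -/
theorem frechetDist_subcurve_seg_le {Z Y : ℝ → EuclideanSpace ℝ (Fin d)} {f : ℝ → ℝ}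
    (hf : IsReparam f) {r a b : ℝ} (hr : ∀ t ∈ Icc (0 : ℝ) 1, ‖Z (f t) - Y t‖ ≤ r)
    (ha : 0 ≤ a) (hab : a < b) (hb : b ≤ 1)
    (hY : ∀ τ ∈ Icc (0 : ℝ) 1, Y (a + τ * (b - a)) = seg (Y a) (Y b) τ) :
    frechetDist (subcurve Z (f a) (f b)) (seg (Z (f a)) (Z (f b))) ≤ 2 * r := by
  have ha' : a ∈ Icc (0 : ℝ) 1 := ⟨ha, hab.le.trans hb⟩
  have hb' : b ∈ Icc (0 : ℝ) 1 := ⟨ha.trans hab.le, hb⟩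
  have hpos : 0 < f b - f a := sub_pos.2 (hf.strictMonoOn ha' hb' hab)
  refine frechetDist_le (hf.restrict ha hab hb) fun τ hτ => ?_
  have hu : a + τ * (b - a) ∈ Icc (0 : ℝ) 1 := by
    obtain ⟨h0, h1⟩ := hτ
    constructor <;> nlinarith
  simp only [subcurve, div_mul_cancel₀ _ hpos.ne', add_sub_cancel]
  have h1 := hr _ hu
  have h2 : ‖Y (a + τ * (b - a)) - seg (Z (f a)) (Z (f b)) τ‖ ≤ r := by
    rw [hY τ hτ]
    exact norm_seg_sub_seg_le (by rw [norm_sub_rev]; exact hr a ha')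
      (by rw [norm_sub_rev]; exact hr b hb') hτ
  linarith [norm_sub_le_norm_sub_add_norm_sub (Z (f (a + τ * (b - a)))) (Y (a + τ * (b - a)))
    (seg (Z (f a)) (Z (f b)) τ)]

/-- Among `N ≥ m` consecutive intervals `[x a, x (a + 1)]` with `x N ≤ m`, one contains no
natural number in its interior. -/
theorem exists_interval_without_interior_nat {m N : ℕ} (hN : 0 < N) (hm : m ≤ N) (x : ℕ → ℝ)
    (hx : x N ≤ m) :
    ∃ a < N, x (a + 1) ≤ ⌊x a⌋₊ + 1 := by
  by_contra! h
  have key : ∀ a ≤ N, a ≤ ⌊x a⌋₊ := by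
    intro a
    induction a with
    | zero => simp
    | succ a ih =>
      intro ha
      have h1 : (a : ℝ) ≤ ⌊x a⌋₊ := by exact_mod_cast ih (by omega)
      refine Nat.le_floor ?_
      push_cast
      linarith [h a ha]
  obtain ⟨n, rfl⟩ : ∃ n, N = n + 1 := ⟨N - 1, by omega⟩
  have h1 : (n : ℝ) ≤ ⌊x n⌋₊ := by exact_mod_cast key n (by omega)
  have h2 : (m : ℝ) ≤ n + 1 := by exact_mod_cast hm
  linarith [h n (by omega)]

/-- Let `k ≥ 2`, `K ≥ 2(k−1)+1` and `s 0 < s 1 < … < s (K-1)` be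
parameters in `[0,1]`. Then for every polygonal curve `Y` with at most `k` vertices there
is an index `i` with `i + 2 < K` such that `d_F(Z, Y)` is at least half the Fréchet
distance between `Z[s i, s (i+2)]` and the segment connecting its endpoints. -/
theorem exists_witness_triple {d : ℕ} (Z : ℝ → EuclideanSpace ℝ (Fin d))
    (hZ : ContinuousOn Z (Icc 0 1))
    (k K : ℕ) (hk : 2 ≤ k) (hK : 2 * (k - 1) + 1 ≤ K)
    (s : Fin K → ℝ) (hmono : StrictMono s)
    (hs0 : 0 ≤ s ⟨0, by omega⟩) (hs1 : s ⟨K - 1, by omega⟩ ≤ 1)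
    (m : ℕ) (y : Fin (m+1) → EuclideanSpace ℝ (Fin d)) (hm : m + 1 ≤ k) :
    ∃ (i : ℕ) (h : i + 2 < K),
      (1 / 2) * frechetDist (subcurve Z (s ⟨i, by omega⟩) (s ⟨i + 2, h⟩))
          (seg (Z (s ⟨i, by omega⟩)) (Z (s ⟨i + 2, h⟩))) ≤
        frechetDist Z (polyCurve y) := by
  have hK3 : 3 ≤ K := by omega
  have : Nonempty (Fin (K - 2)) := ⟨⟨0, by omega⟩⟩
  obtain ⟨i, hi⟩ := Finite.exists_min fun i : Fin (K - 2) =>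
    frechetDist (subcurve Z (s ⟨i, by omega⟩) (s ⟨i + 2, by omega⟩))
      (seg (Z (s ⟨i, by omega⟩)) (Z (s ⟨i + 2, by omega⟩)))
  refine ⟨i, by omega, le_frechetDist fun f hf => ?_⟩
  obtain ⟨C, hC⟩ := exists_norm_polyCurve_le y
  have hs (l : Fin K) : s l ∈ Icc (0 : ℝ) 1 :=
    ⟨hs0.trans (hmono.monotone (Fin.mk_le_of_le_val (Nat.zero_le _))),
      (hmono.monotone (Fin.le_def.2 (Nat.le_sub_one_of_lt l.2))).trans hs1⟩
  choose t ht hft using fun l => hf.surjOn (hs l)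
  have htmono : StrictMono t := fun p q hpq => by
    rw [← hf.strictMonoOn.lt_iff_lt (ht p) (ht q), hft, hft]
    exact hmono hpq
  obtain ⟨a, ha, hedge⟩ := exists_interval_without_interior_nat (m := m) (N := k - 1)
    (by omega) (by omega) (fun a => t ⟨min (2 * a) (K - 1), by omega⟩ * m)
    (mul_le_of_le_one_left m.cast_nonneg (ht _).2)
  have e1 : min (2 * a) (K - 1) = 2 * a := by omega
  have e2 : min (2 * (a + 1)) (K - 1) = 2 * a + 2 := by omega
  simp only [e1, e2] at hedge
  have hlt : t ⟨2 * a, by omega⟩ < t ⟨2 * a + 2, by omega⟩ :=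
    htmono (Fin.mk_lt_mk.2 (by omega))
  have hle := frechetDist_subcurve_seg_le hf
    (fun u hu => norm_sub_le_frechetWidth hZ hC hf hu) (ht _).1 hlt (ht _).2
    fun τ hτ => polyCurve_eq_seg y hlt.le
      (Nat.floor_le (mul_nonneg (ht _).1 m.cast_nonneg)) hedge hτ
  simp only [hft] at hle
  have hmin := hi ⟨2 * a, by omega⟩
  simp only at hmin
  linarith

end Jaywalk
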